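/- arXiv:2306.12009 — 5 statements merged into one kernel-verified Lean document; each statement's English description precedes it below -/
import Mathlib

section
/- Let λ be a nonzero real number, let n ≥ 1 be an integer, and let y be a real number with |y| < 1. Then the series Σ_{k=0}^∞ y^k · (k)_{n,λ} · (H_{k,λ} + log_λ(1−y)) converges absolutely, and (1/(1−y)) · HF_{n,λ}(y/(1−y)) = (1−y)^{−λ} · Σ_{k=0}^∞ y^k · (k)_{n,λ} · (H_{k,λ} + log_λ(1−y)), where log_λ(1−y) = ((1−y)^λ − 1)/λ. -/
open Finset

/-- The degenerate falling factorial `(x)_{n,λ} = x(x-λ)⋯(x-(n-1)λ)`. -/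
noncomputable def degFall (lam x : ℝ) (n : ℕ) : ℝ := ∏ i ∈ Finset.range n, (x - (i : ℝ) * lam)

/-- The ordinary falling factorial `(x)_n = x(x-1)⋯(x-n+1)`. -/
noncomputable def fall (x : ℝ) (n : ℕ) : ℝ := ∏ i ∈ Finset.range n, (x - (i : ℝ))

/-- The rising factorial `⟨a⟩_k = a(a+1)⋯(a+k-1)`. -/
noncomputable def rising (a : ℝ) (k : ℕ) : ℝ := ∏ i ∈ Finset.range k, (a + (i : ℝ))

/-- The generalized binomial coefficient `binom(a,k) = a(a-1)⋯(a-k+1)/k!`. -/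
noncomputable def rchoose (a : ℝ) (k : ℕ) : ℝ :=
  (∏ i ∈ Finset.range k, (a - (i : ℝ))) / (k.factorial : ℝ)

/-- The degenerate harmonic numbers `H_{n,λ} = Σ_{k=1}^n (1/k)·binom(k-1-λ, k-1)`. -/
noncomputable def degH (lam : ℝ) (n : ℕ) : ℝ :=
  ∑ k ∈ Finset.Icc 1 n, (1 / (k : ℝ)) * rchoose ((k : ℝ) - 1 - lam) (k - 1)

/-- The degenerate hyperharmonic numbers `H^{(r)}_{n,λ}`. -/
noncomputable def degHyperH (lam : ℝ) : ℕ → ℕ → ℝ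
  | 0, _ => 0
  | 1, n => degH lam n
  | r + 2, n => ∑ k ∈ Finset.Icc 1 n, degHyperH lam (r + 1) k

/-- The degenerate harmonic-Fubini polynomial built from degenerate Stirling numbers `S2`. -/
noncomputable def HFpoly (lam : ℝ) (S2 : ℕ → ℕ → ℝ) (n : ℕ) (x : ℝ) : ℝ :=
  ∑ k ∈ Finset.Icc 1 n, S2 n k * degH lam k * (k.factorial : ℝ) * x ^ k

/-- The degenerate Fubini polynomial of order `1-λ` built from degenerate Stirling numbers `S2`. -/
noncomputable def Fpoly (lam : ℝ) (S2 : ℕ → ℕ → ℝ) (n : ℕ) (x : ℝ) : ℝ :=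
  ∑ k ∈ Finset.range (n + 1), rising (1 - lam) k * S2 n k * x ^ k

/-- The degenerate hyperharmonic-Fubini polynomial built from degenerate Stirling numbers `S2`. -/
noncomputable def HFpolyR (lam : ℝ) (S2 : ℕ → ℕ → ℝ) (r n : ℕ) (y : ℝ) : ℝ :=
  ∑ k ∈ Finset.Icc 1 n, S2 n k * degHyperH lam r k * (k.factorial : ℝ) * y ^ k

/-- The degenerate falling factorial power of the operator `θ = x·d/dx`:
`(θ)_{k,λ} = (θ - (k-1)λ) ∘ ⋯ ∘ (θ - λ) ∘ θ`. -/
noncomputable def thetaFall (lam : ℝ) : ℕ → (ℝ → ℝ) → ℝ → ℝ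
  | 0, g => g
  | k + 1, g => fun x => x * deriv (thetaFall lam k g) x - (k : ℝ) * lam * thetaFall lam k g x

theorem rising_succ (a : ℝ) (k : ℕ) : rising a (k + 1) = rising a k * (a + k) :=
  Finset.prod_range_succ _ _

theorem ascPochhammer_eval_eq_rising (a : ℝ) (k : ℕ) :
    (ascPochhammer ℝ k).eval a = rising a k := by
  induction k with
  | zero => simp [rising]
  | succ k ih => rw [ascPochhammer_succ_eval, ih, rising_succ]

theorem ring_choose_eq_rising_div (a : ℝ) (k : ℕ) :
    Ring.choose (a + k - 1) k = rising a k / (k.factorial : ℝ) := by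
  have h := Ring.factorial_nsmul_multichoose_eq_ascPochhammer a k
  rw [Polynomial.ascPochhammer_smeval_eq_eval, ascPochhammer_eval_eq_rising, nsmul_eq_mul,
    Ring.multichoose_eq] at h
  rw [eq_div_iff (by positivity), mul_comm, h]

/-- The binomial series with negative exponent. -/
theorem hasSum_rising_div_factorial_mul_pow (a : ℝ) {y : ℝ} (hy : |y| < 1) :
    HasSum (fun k : ℕ => rising a k / (k.factorial : ℝ) * y ^ k) ((1 - y) ^ (-a)) := by
  have hpos : 0 < 1 - y := sub_pos.2 (abs_lt.1 hy).2
  have h := (Real.one_div_one_sub_rpow_hasFPowerSeriesOnBall_zero a).hasSum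
    (y := y) (by simpa [enorm_eq_nnnorm, ← NNReal.coe_lt_coe] using hy)
  simpa [ring_choose_eq_rising_div, Real.rpow_neg hpos.le, FormalMultilinearSeries.ofScalars,
    mul_comm] using h

theorem rising_add (a : ℝ) (m j : ℕ) : rising a (m + j) = rising a m * rising (a + m) j := by
  simp [rising, Finset.prod_range_add, add_assoc]

theorem rising_one (m : ℕ) : rising 1 m = (m.factorial : ℝ) := by
  induction m with
  | zero => simp [rising]
  | succ m ih =>
    rw [rising_succ, ih, Nat.factorial_succ]
    push_cast
    ring

theorem fall_natCast_eq_zero {k m : ℕ} (h : k < m) : fall k m = 0 :=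
  Finset.prod_eq_zero (Finset.mem_range.2 h) (sub_self _)

theorem factorial_mul_fall_natCast_add (j m : ℕ) :
    (j.factorial : ℝ) * fall (j + m : ℕ) m = ((j + m).factorial : ℝ) := by
  induction m generalizing j with
  | zero => simp [fall]
  | succ m ih =>
    have h := ih (j + 1)
    rw [fall, Finset.prod_range_succ, ← fall, show j + (m + 1) = j + 1 + m by ring, ← h,
      Nat.factorial_succ]
    push_cast
    ring

theorem hasSum_fall_mul_rising_mul_pow (a : ℝ) (m : ℕ) {y : ℝ} (hy : |y| < 1) :
    HasSum (fun k : ℕ => fall k m * (rising a k / (k.factorial : ℝ)) * y ^ k)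
      (rising a m * y ^ m * (1 - y) ^ (-(a + m))) := by
  rw [← hasSum_nat_add_iff' m, Finset.sum_eq_zero fun i hi => by
    rw [fall_natCast_eq_zero (Finset.mem_range.1 hi), zero_mul, zero_mul], sub_zero]
  convert! (hasSum_rising_div_factorial_mul_pow (a + m) hy).mul_left (rising a m * y ^ m)
    using 2 with j
  rw [← factorial_mul_fall_natCast_add, add_comm j m, rising_add, pow_add]
  have hj : (j.factorial : ℝ) ≠ 0 := by positivity
  have hf : fall (m + j : ℕ) m ≠ 0 := by
    have := factorial_mul_fall_natCast_add j m
    rw [add_comm j m] at this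
    exact right_ne_zero_of_mul (a := (j.factorial : ℝ)) (by rw [this]; positivity)
  field_simp

theorem rchoose_eq_rising_div (lam : ℝ) (m : ℕ) :
    rchoose ((m : ℝ) - lam) m = rising (1 - lam) m / (m.factorial : ℝ) := by
  rw [rchoose, rising, ← Finset.prod_range_reflect]
  congr 1
  refine Finset.prod_congr rfl fun i hi => ?_
  have : i + 1 ≤ m := Finset.mem_range.1 hi
  rw [Nat.sub_sub, add_comm 1 i, Nat.cast_sub this]
  push_cast
  ring

theorem mul_degH (lam : ℝ) (m : ℕ) :
    lam * degH lam m = 1 - rising (1 - lam) m / (m.factorial : ℝ) := by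
  induction m with
  | zero => simp [degH, rising]
  | succ m ih =>
    rw [degH, Finset.sum_Icc_succ_top (Nat.le_add_left 1 m), ← degH, mul_add, ih, rising_succ,
      Nat.add_sub_cancel, Nat.cast_succ, add_sub_cancel_right,
      rchoose_eq_rising_div, Nat.factorial_succ]
    push_cast
    field_simp
    ring

theorem degH_eq {lam : ℝ} (hlam : lam ≠ 0) (m : ℕ) :
    degH lam m = (1 - rising (1 - lam) m / (m.factorial : ℝ)) / lam := by
  rw [eq_div_iff hlam, mul_comm, mul_degH]

theorem hasSum_fall_mul_degH_add {lam : ℝ} (hlam : lam ≠ 0) (m : ℕ) {y : ℝ} (hy : |y| < 1) :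
    HasSum (fun k : ℕ => y ^ k * fall k m * (degH lam k + ((1 - y) ^ lam - 1) / lam))
      ((1 - y) ^ lam *
        (1 / (1 - y) * (degH lam m * (m.factorial : ℝ) * (y / (1 - y)) ^ m))) := by
  have hpos : 0 < 1 - y := sub_pos.2 (abs_lt.1 hy).2
  convert! ((((hasSum_fall_mul_rising_mul_pow 1 m hy).mul_left ((1 - y) ^ lam)).sub
    (hasSum_fall_mul_rising_mul_pow (1 - lam) m hy)).div_const lam) using 1
  · ext k
    rw [degH_eq hlam, rising_one, div_self (by positivity)]
    ring
  · have h₁ : (1 - y) ^ (-(1 + m : ℝ)) = 1 / (1 - y) * (1 / (1 - y)) ^ m := by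
      rw [Real.rpow_neg hpos.le, add_comm, Real.rpow_add_one hpos.ne', Real.rpow_natCast, one_div_pow]
      field_simp
    have h₂ : (1 - y) ^ (-(1 - lam + m)) = (1 - y) ^ lam * (1 - y) ^ (-(1 + m : ℝ)) := by
      rw [← Real.rpow_add hpos]
      ring_nf
    rw [h₂, h₁, degH_eq hlam, rising_one]
    have hm : (m.factorial : ℝ) ≠ 0 := by positivity
    rw [div_eq_mul_one_div y, mul_pow]
    field_simp

theorem stmt3 (lam : ℝ) (hlam : lam ≠ 0) (n : ℕ) (hn : 1 ≤ n) (y : ℝ) (hy : |y| < 1)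
    (S2 : ℕ → ℕ → ℝ)
    (hS2 : ∀ (m : ℕ) (z : ℝ), degFall lam z m = ∑ k ∈ Finset.range (m + 1), S2 m k * fall z k) :
    Summable (fun k : ℕ =>
      |y ^ k * degFall lam (k : ℝ) n * (degH lam k + ((1 - y) ^ lam - 1) / lam)|) ∧
    (1 / (1 - y)) * HFpoly lam S2 n (y / (1 - y))
      = (1 - y) ^ (-lam) *
        ∑' k : ℕ, y ^ k * degFall lam (k : ℝ) n * (degH lam k + ((1 - y) ^ lam - 1) / lam) := by
  have hpos : 0 < 1 - y := sub_pos.2 (abs_lt.1 hy).2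
  have hsum := hasSum_sum (s := Finset.range (n + 1)) fun m _ =>
    (hasSum_fall_mul_degH_add hlam m hy).mul_left (S2 n m)
  have hterm : (fun k : ℕ => ∑ m ∈ Finset.range (n + 1),
      S2 n m * (y ^ k * fall k m * (degH lam k + ((1 - y) ^ lam - 1) / lam))) =
      fun k : ℕ => y ^ k * degFall lam k n * (degH lam k + ((1 - y) ^ lam - 1) / lam) := by
    ext k
    rw [hS2, Finset.mul_sum, Finset.sum_mul]
    exact Finset.sum_congr rfl fun m _ => by ring
  have hvalue : ∑ m ∈ Finset.range (n + 1), S2 n m * ((1 - y) ^ lam *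
      (1 / (1 - y) * (degH lam m * (m.factorial : ℝ) * (y / (1 - y)) ^ m))) =
      (1 - y) ^ lam * (1 / (1 - y) * HFpoly lam S2 n (y / (1 - y))) := by
    rw [HFpoly, Finset.range_eq_Ico, Finset.sum_eq_sum_Ico_succ_bot n.succ_pos, zero_add,
      Finset.mul_sum, Finset.mul_sum]
    have h₀ : degH lam 0 = 0 := by simp [degH]
    rw [h₀, zero_mul, zero_mul, mul_zero, mul_zero, mul_zero, zero_add]
    exact Finset.sum_congr rfl fun m _ => by ring
  rw [hterm, hvalue] at hsum
  refine ⟨hsum.summable.abs, ?_⟩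
  rw [hsum.tsum_eq, ← mul_assoc ((1 - y) ^ (-lam)), ← Real.rpow_add hpos, neg_add_cancel,
    Real.rpow_zero, one_mul]
end

section
/- Let r ≥ 1 and n ≥ 1 be integers, let y be a real number, and let λ be a nonzero real number that is not one of 1, 2, …, r−1 (so that binom(r−1−λ, r−1) ≠ 0). Then HF^{(r)}_{n,λ}(y) = Σ_{k=1}^n ( binom(k+r−1, r−1) / binom(r−1−λ, r−1) ) · (H_{k+r−1,λ} − H_{r−1,λ}) · k! · S2_λ(n,k) · y^k. -/
open Finset

theorem rchoose_natCast (n k : ℕ) : rchoose (n : ℝ) k = (n.choose k : ℝ) := by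
  rw [rchoose, ← descPochhammer_eval_eq_prod_range, descPochhammer_eval_eq_descFactorial,
    Nat.descFactorial_eq_factorial_mul_choose, Nat.cast_mul]
  field_simp

theorem rchoose_succ_sub (lam : ℝ) (m : ℕ) :
    rchoose (((m + 1 : ℕ) : ℝ) - lam) (m + 1)
      = rchoose ((m : ℝ) - lam) m * ((m : ℝ) + 1 - lam) / ((m : ℝ) + 1) := by
  have hprod : ∏ i ∈ range m, (((m + 1 : ℕ) : ℝ) - lam - ((i + 1 : ℕ) : ℝ))
      = ∏ i ∈ range m, ((m : ℝ) - lam - (i : ℝ)) :=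
    prod_congr rfl fun i _ => by push_cast; ring
  rw [rchoose, rchoose, prod_range_succ', hprod, Nat.factorial_succ]
  push_cast
  field_simp
  ring

theorem degH_succ (lam : ℝ) (m : ℕ) :
    degH lam (m + 1) = degH lam m + rchoose ((m : ℝ) - lam) m / ((m : ℝ) + 1) := by
  rw [degH, degH, sum_Icc_succ_top (by omega), Nat.add_sub_cancel]
  push_cast
  rw [add_sub_cancel_right]
  ring

theorem rchoose_sub_add_mul_degH (lam : ℝ) (m : ℕ) :
    rchoose ((m : ℝ) - lam) m + lam * degH lam m = 1 := by
  induction m with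
  | zero => simp [rchoose, degH]
  | succ m ih =>
    rw [rchoose_succ_sub, degH_succ, ← ih]
    field_simp
    ring

theorem rchoose_sub_ne_zero (lam : ℝ) (s : ℕ)
    (h : ∀ j : ℕ, 1 ≤ j → j ≤ s → lam ≠ (j : ℝ)) : rchoose ((s : ℝ) - lam) s ≠ 0 := by
  refine div_ne_zero (prod_ne_zero_iff.mpr fun i hi heq => ?_) (by positivity)
  have hi := mem_range.mp hi
  refine h (s - i) (by omega) (by omega) ?_
  rw [Nat.cast_sub hi.le]
  linarith

theorem degHyperH_mul_rchoose (lam : ℝ) (s k : ℕ) :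
    degHyperH lam (s + 1) k * rchoose ((s : ℝ) - lam) s
      = ((k + s).choose s : ℝ) * (degH lam (k + s) - degH lam s) := by
  induction s generalizing k with
  | zero => simp [degHyperH, rchoose, degH]
  | succ s ih =>
    induction k with
    | zero => simp [degHyperH]
    | succ k ihk =>
      have hrec : degHyperH lam (s + 1 + 1) (k + 1)
          = degHyperH lam (s + 1 + 1) k + degHyperH lam (s + 1) (k + 1) := by
        simp only [degHyperH]
        rw [sum_Icc_succ_top (by omega)]
      have hs := ih (k + 1)
      rw [hrec, add_mul, ihk, rchoose_succ_sub, mul_div_assoc, ← mul_assoc, hs]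
      obtain ⟨N, hN⟩ : ∃ N, N = k + (s + 1) := ⟨_, rfl⟩
      rw [show k + 1 + s = N by omega, show k + 1 + (s + 1) = N + 1 by omega, ← hN,
        degH_succ lam N, degH_succ lam s]
      have hpascal : ((N + 1).choose (s + 1) : ℝ) = N.choose s + N.choose (s + 1) := by
        exact_mod_cast Nat.choose_succ_succ N s
      have habsorb : ((N : ℝ) + 1) * N.choose s = (N + 1).choose (s + 1) * ((s : ℝ) + 1) := by
        exact_mod_cast Nat.add_one_mul_choose_eq N s
      have hquot : ((N + 1).choose (s + 1) : ℝ) / ((N : ℝ) + 1) = N.choose s / ((s : ℝ) + 1) := by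
        rw [div_eq_div_iff (by positivity) (by positivity), ← habsorb, mul_comm]
      have hbN : rchoose ((N : ℝ) - lam) N = 1 - lam * degH lam N := by
        linarith [rchoose_sub_add_mul_degH lam N]
      have hbs : rchoose ((s : ℝ) - lam) s = 1 - lam * degH lam s := by
        linarith [rchoose_sub_add_mul_degH lam s]
      have hsplit : ((N + 1).choose (s + 1) : ℝ) * (degH lam N
            + rchoose ((N : ℝ) - lam) N / ((N : ℝ) + 1)
            - (degH lam s + rchoose ((s : ℝ) - lam) s / ((s : ℝ) + 1)))
          = ((N + 1).choose (s + 1) : ℝ) * (degH lam N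
              - (degH lam s + rchoose ((s : ℝ) - lam) s / ((s : ℝ) + 1)))
            + (N.choose s : ℝ) / ((s : ℝ) + 1) * rchoose ((N : ℝ) - lam) N := by
        rw [← hquot]
        ring
      rw [hsplit, hpascal, hbN, hbs]
      field_simp
      ring

theorem stmt4 (lam : ℝ) (hlam : lam ≠ 0) (r n : ℕ) (hr : 1 ≤ r) (hn : 1 ≤ n) (y : ℝ)
    (hlam' : ∀ j : ℕ, 1 ≤ j → j ≤ r - 1 → lam ≠ (j : ℝ))
    (S2 : ℕ → ℕ → ℝ)
    (hS2 : ∀ (m : ℕ) (z : ℝ), degFall lam z m = ∑ k ∈ Finset.range (m + 1), S2 m k * fall z k) :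
    HFpolyR lam S2 r n y
      = ∑ k ∈ Finset.Icc 1 n,
          (rchoose ((k + r - 1 : ℕ) : ℝ) (r - 1) / rchoose ((r : ℝ) - 1 - lam) (r - 1)) *
            (degH lam (k + r - 1) - degH lam (r - 1)) * (k.factorial : ℝ) * S2 n k * y ^ k := by
  obtain ⟨s, rfl⟩ : ∃ s, r = s + 1 := ⟨r - 1, by omega⟩
  have hb := rchoose_sub_ne_zero lam s hlam'
  refine sum_congr rfl fun k _ => ?_
  have hr' : ((s + 1 : ℕ) : ℝ) - 1 - lam = (s : ℝ) - lam := by push_cast; ring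
  rw [hr', rchoose_natCast, show k + (s + 1) - 1 = k + s by omega, Nat.add_sub_cancel,
    div_mul_eq_mul_div, ← degHyperH_mul_rchoose, mul_div_cancel_right₀ _ hb]
  ring
end

section
/- Let λ be a nonzero real number and let k ≥ 1 be an integer. Let g(t) = −log_λ(1−t)/(1−t) for real t < 1. Then g is smooth on (−∞,1) and its k-th derivative is g^(k)(t) = −⟨1−λ⟩_k · log_λ(1−t)/(1−t)^{k+1} + (k! − ⟨1−λ⟩_k)/(λ·(1−t)^{k+1}) for all t < 1, where log_λ(1−t) = ((1−t)^λ − 1)/λ. -/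
open Finset

/-- The `k`-th derivative of `t ↦ -log_λ(1 - t) / (1 - t)` on `t < 1`, over a common
denominator. -/
theorem iteratedDeriv_neg_degLog_div (lam : ℝ) (hlam : lam ≠ 0) (k : ℕ) {t : ℝ} (ht : t < 1) :
    iteratedDeriv k (fun t : ℝ => -(((1 - t) ^ lam - 1) / lam) / (1 - t)) t
      = ((k.factorial : ℝ) - rising (1 - lam) k * (1 - t) ^ lam) / (lam * (1 - t) ^ (k + 1)) := by
  induction k generalizing t with
  | zero =>
    have h : 1 - t ≠ 0 := by linarith
    simp only [iteratedDeriv_zero, rising, Finset.prod_range_zero, Nat.factorial_zero]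
    field_simp
    push_cast
    ring
  | succ k ih =>
    have hpos : 0 < 1 - t := by linarith
    have hev : iteratedDeriv k (fun t : ℝ => -(((1 - t) ^ lam - 1) / lam) / (1 - t)) =ᶠ[nhds t]
        fun t => ((k.factorial : ℝ) - rising (1 - lam) k * (1 - t) ^ lam) /
          (lam * (1 - t) ^ (k + 1)) := by
      filter_upwards [Iio_mem_nhds ht] with s hs using ih hs
    have hsub : HasDerivAt (fun t : ℝ => 1 - t) (-1) t := by
      simpa using (hasDerivAt_id t).const_sub 1
    have hnum := ((hsub.rpow_const (p := lam) (Or.inl hpos.ne')).const_mul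
      (rising (1 - lam) k)).const_sub (k.factorial : ℝ)
    have hden := (hsub.fun_pow (k + 1)).const_mul lam
    have hden0 : lam * (1 - t) ^ (k + 1) ≠ 0 := mul_ne_zero hlam (pow_pos hpos _).ne'
    rw [iteratedDeriv_succ, hev.deriv_eq, (hnum.fun_div hden hden0).deriv,
      Real.rpow_sub_one hpos.ne', Nat.factorial_succ]
    simp only [rising, Finset.prod_range_succ, Nat.add_sub_cancel]
    push_cast
    field_simp
    ring

theorem stmt13 (lam : ℝ) (hlam : lam ≠ 0) (k : ℕ) (hk : 1 ≤ k) :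
    ContDiffOn ℝ (⊤ : ℕ∞) (fun t : ℝ => -(((1 - t) ^ lam - 1) / lam) / (1 - t)) (Set.Iio 1) ∧
    ∀ t : ℝ, t < 1 →
      iteratedDeriv k (fun t : ℝ => -(((1 - t) ^ lam - 1) / lam) / (1 - t)) t
        = -(rising (1 - lam) k) * (((1 - t) ^ lam - 1) / lam) / (1 - t) ^ (k + 1)
          + ((k.factorial : ℝ) - rising (1 - lam) k) / (lam * (1 - t) ^ (k + 1)) := by
  refine ⟨?_, fun t ht => ?_⟩
  · have hsub : ContDiffOn ℝ (⊤ : ℕ∞) (fun t : ℝ => 1 - t) (Set.Iio 1) :=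
      (contDiff_const.sub contDiff_id).contDiffOn
    have hne : ∀ t ∈ Set.Iio (1 : ℝ), 1 - t ≠ 0 := fun t ht => (sub_pos.2 ht).ne'
    exact (((hsub.rpow_const_of_ne hne).sub contDiffOn_const).div_const lam).neg.div hsub hne
  · have hne : 1 - t ≠ 0 := (sub_pos.2 ht).ne'
    rw [iteratedDeriv_neg_degLog_div lam hlam k ht]
    field_simp
    ring
end

section
/- Let λ be a nonzero real number and let r ≥ 1 and k ≥ 1 be integers. Let g(t) = −log_λ(1−t)/(1−t)^r for real t < 1. Then g is smooth on (−∞,1) and its k-th derivative is g^(k)(t) = −⟨r−λ⟩_k · log_λ(1−t)/(1−t)^{r+k} + (⟨r⟩_k − ⟨r−λ⟩_k)/(λ·(1−t)^{r+k}) for all t < 1, where log_λ(1−t) = ((1−t)^λ − 1)/λ. -/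
open Finset

theorem contDiffAt_one_sub_rpow (s : ℝ) {n : WithTop ℕ∞} {t : ℝ} (ht : t < 1) :
    ContDiffAt ℝ n (fun u : ℝ => (1 - u) ^ s) t :=
  (contDiffAt_const.sub contDiffAt_id).rpow_const_of_ne (sub_pos.2 ht).ne'

theorem iteratedDeriv_one_sub_rpow (s : ℝ) (k : ℕ) {t : ℝ} (ht : t < 1) :
    iteratedDeriv k (fun u : ℝ => (1 - u) ^ s) t = rising (-s) k * (1 - t) ^ (s - k) := by
  induction k generalizing t with
  | zero => simp [rising]
  | succ k ih =>
    have heq : iteratedDeriv k (fun u : ℝ => (1 - u) ^ s) =ᶠ[nhds t]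
        fun u => rising (-s) k * (1 - u) ^ (s - k) := by
      filter_upwards [Iio_mem_nhds ht] with u hu using ih hu
    have hderiv := (((hasDerivAt_id t).const_sub 1).rpow_const (p := s - k)
      (Or.inl (sub_pos.2 ht).ne')).const_mul (rising (-s) k)
    rw [iteratedDeriv_succ, heq.deriv_eq, rising_succ]
    refine hderiv.deriv.trans ?_
    rw [Nat.cast_succ, ← sub_sub]
    simp only [id]
    ring

/-- The quotient `-log_λ(1-t)/(1-t)^r` is a combination of two real powers of `1 - t`. -/
theorem neg_degLog_div_pow_eq (lam : ℝ) (r : ℕ) {t : ℝ} (ht : t < 1) :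
    -(((1 - t) ^ lam - 1) / lam) / (1 - t) ^ r
      = lam⁻¹ * ((1 - t) ^ (-(r : ℝ)) - (1 - t) ^ (lam - r)) := by
  have h := sub_pos.2 ht
  rw [Real.rpow_neg h.le, Real.rpow_sub h, Real.rpow_natCast]
  ring

theorem stmt14 (lam : ℝ) (hlam : lam ≠ 0) (r k : ℕ) (hr : 1 ≤ r) (hk : 1 ≤ k) :
    ContDiffOn ℝ (⊤ : ℕ∞) (fun t : ℝ => -(((1 - t) ^ lam - 1) / lam) / (1 - t) ^ r) (Set.Iio 1) ∧
    ∀ t : ℝ, t < 1 →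
      iteratedDeriv k (fun t : ℝ => -(((1 - t) ^ lam - 1) / lam) / (1 - t) ^ r) t
        = -(rising ((r : ℝ) - lam) k) * (((1 - t) ^ lam - 1) / lam) / (1 - t) ^ (r + k)
          + (rising (r : ℝ) k - rising ((r : ℝ) - lam) k) / (lam * (1 - t) ^ (r + k)) := by
  constructor
  · refine ContDiffOn.congr (fun t ht => ?_) fun t ht => neg_degLog_div_pow_eq lam r ht
    exact (contDiffAt_const.mul ((contDiffAt_one_sub_rpow _ ht).sub
      (contDiffAt_one_sub_rpow _ ht))).contDiffWithinAt
  · intro t ht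
    have h := sub_pos.2 ht
    have heq : (fun t : ℝ => -(((1 - t) ^ lam - 1) / lam) / (1 - t) ^ r) =ᶠ[nhds t]
        fun t => lam⁻¹ * ((1 - t) ^ (-(r : ℝ)) - (1 - t) ^ (lam - r)) := by
      filter_upwards [Iio_mem_nhds ht] with u hu using neg_degLog_div_pow_eq lam r hu
    rw [heq.iteratedDeriv_eq, iteratedDeriv_const_mul_field,
      iteratedDeriv_fun_sub (contDiffAt_one_sub_rpow _ ht) (contDiffAt_one_sub_rpow _ ht),
      iteratedDeriv_one_sub_rpow _ k ht, iteratedDeriv_one_sub_rpow _ k ht, neg_neg, neg_sub,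
      ← neg_add', sub_sub, ← Nat.cast_add, Real.rpow_neg h.le, Real.rpow_sub h, Real.rpow_natCast]
    field_simp
    ring
end

section
/- Let λ be a nonzero real number and let t be a real number with |t| < 1. Then the series Σ_{n=1}^∞ H_{n,λ} · t^n converges absolutely and −log_λ(1−t)/(1−t) = Σ_{n=1}^∞ H_{n,λ} · t^n, where log_λ(1−t) = ((1−t)^λ − 1)/λ. -/
open Finset

/-- The generalized binomial coefficient agrees with `Ring.choose`. -/
theorem ringChoose_eq_rchoose (a : ℝ) (k : ℕ) : Ring.choose a k = rchoose a k := by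
  rw [Ring.choose_eq_smul, ← Polynomial.aeval_eq_smeval, ← Polynomial.eval_map_algebraMap,
    descPochhammer_map, rchoose, descPochhammer_eval_eq_prod_range, smul_eq_mul, div_eq_inv_mul]

/-- The last factor of `binom(k-λ, k+1)` is `-λ`. -/
theorem rchoose_sub_succ (lam : ℝ) (k : ℕ) :
    rchoose ((k : ℝ) - lam) (k + 1) = -lam * (1 / ((k : ℝ) + 1) * rchoose ((k : ℝ) - lam) k) := by
  have hk : (k : ℝ) + 1 ≠ 0 := by positivity
  rw [rchoose, rchoose, Finset.prod_range_succ, Nat.factorial_succ]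
  push_cast
  field_simp
  ring

/-- The negative-binomial series `(1-t)^λ = Σ binom(n-1-λ, n) t^n`. -/
theorem hasSum_one_sub_rpow (lam t : ℝ) (ht : |t| < 1) :
    HasSum (fun n : ℕ => rchoose (-lam + n - 1) n * t ^ n) ((1 - t) ^ lam) := by
  have hmem : t ∈ Metric.eball (0 : ℝ) 1 := by
    simpa [Metric.mem_eball, edist_dist, Real.dist_eq] using ht
  have h := (Real.one_div_one_sub_rpow_hasFPowerSeriesOnBall_zero (-lam)).hasSum hmem
  have hpos : 0 < 1 - t := by linarith [(abs_lt.mp ht).2]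
  simpa [FormalMultilinearSeries.ofScalars, ringChoose_eq_rchoose, Real.rpow_neg hpos.le] using h

/-- The power series of `-log_λ(1-t)`. -/
theorem hasSum_neg_degLog_one_sub (lam : ℝ) (hlam : lam ≠ 0) (t : ℝ) (ht : |t| < 1) :
    HasSum (fun n : ℕ => 1 / ((n : ℝ) + 1) * rchoose ((n : ℝ) - lam) n * t ^ (n + 1))
      (-(((1 - t) ^ lam - 1) / lam)) := by
  have h := (hasSum_nat_add_iff' 1).mpr (hasSum_one_sub_rpow lam t ht)
  convert! h.mul_left (-lam⁻¹) using 1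
  · funext n
    have hn : -lam + ((n + 1 : ℕ) : ℝ) - 1 = (n : ℝ) - lam := by push_cast; ring
    rw [hn, rchoose_sub_succ]
    field_simp
  · simp [rchoose]
    ring

theorem degH_eq_sum_range (lam : ℝ) (n : ℕ) :
    degH lam n = ∑ k ∈ Finset.range n, 1 / ((k : ℝ) + 1) * rchoose ((k : ℝ) - lam) k := by
  rw [degH, ← Finset.Ico_add_one_right_eq_Icc, Finset.sum_Ico_eq_sum_range]
  refine Finset.sum_congr (by simp) fun k _ => ?_
  have hk : ((1 + k : ℕ) : ℝ) - 1 - lam = (k : ℝ) - lam := by push_cast; ring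
  rw [hk, Nat.add_sub_cancel_left]
  push_cast
  rw [add_comm (1 : ℝ)]

/-- `degH (n + 1) * t ^ (n + 1)` is a Cauchy product with the geometric series. -/
theorem degH_succ_mul_pow (lam t : ℝ) (n : ℕ) :
    degH lam (n + 1) * t ^ (n + 1) = ∑ k ∈ Finset.range (n + 1),
      (1 / ((k : ℝ) + 1) * rchoose ((k : ℝ) - lam) k * t ^ (k + 1)) * t ^ (n - k) := by
  rw [degH_eq_sum_range, Finset.sum_mul]
  refine Finset.sum_congr rfl fun k hk => ?_
  have hkn : n + 1 = (k + 1) + (n - k) := by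
    have := Finset.mem_range.mp hk
    omega
  rw [mul_assoc _ (t ^ (k + 1)), ← pow_add, ← hkn]

theorem stmt17 (lam : ℝ) (hlam : lam ≠ 0) (t : ℝ) (ht : |t| < 1) :
    Summable (fun n : ℕ => |degH lam n * t ^ n|) ∧
    -(((1 - t) ^ lam - 1) / lam) / (1 - t) = ∑' n : ℕ, degH lam n * t ^ n := by
  have hf := hasSum_neg_degLog_one_sub lam hlam t ht
  have hg : Summable fun n : ℕ => ‖t ^ n‖ := by
    simpa using summable_geometric_of_lt_one (abs_nonneg t) ht
  have hs := summable_norm_sum_mul_range_of_summable_norm hf.summable.norm hg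
  have hp := tsum_mul_tsum_eq_tsum_sum_range_of_summable_norm hf.summable.norm hg
  simp_rw [← degH_succ_mul_pow] at hs hp
  have habs : Summable fun n : ℕ => |degH lam n * t ^ n| :=
    (summable_nat_add_iff 1).mp hs
  refine ⟨habs, ?_⟩
  rw [habs.of_abs.tsum_eq_zero_add, ← hp, hf.tsum_eq,
    tsum_geometric_of_norm_lt_one (by simpa using ht)]
  simp [degH, div_eq_mul_inv]
end
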